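/- arXiv:2409.08333 — 3 statements merged into one kernel-verified Lean document; each statement's English description precedes it below -/
import Mathlib

section
/- Let A = kQ/I be a (locally) gentle algebra. For every arrow α ∈ Q1, exactly one of the following holds: (1) α is contained in a unique finite maximal path of A; (2) α is contained in a unique primitive cycle c with first arrow α such that c² ∉ I. -/
/- Common framework for (locally) gentle algebras -/

noncomputable section
open scoped BigOperators
open CategoryTheory

namespace LocGentle

/-- A finite connected quiver with at least one vertex and one arrow. -/
structure Quiv where
  V : Type
  Arr : Type
  [fintypeV : Fintype V]
  [fintypeA : Fintype Arr]
  [decEqV : DecidableEq V]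
  [decEqA : DecidableEq Arr]
  src : Arr → V
  tgt : Arr → V
  [nonemptyV : Nonempty V]
  [nonemptyA : Nonempty Arr]
  connected : (SimpleGraph.fromRel (fun v w => ∃ a, src a = v ∧ tgt a = w)).Connected

attribute [instance] Quiv.fintypeV Quiv.fintypeA Quiv.decEqV Quiv.decEqA
  Quiv.nonemptyV Quiv.nonemptyA

variable (Q : Quiv)

/-- in-degree of a vertex -/
def indeg (v : Q.V) : ℕ := (Finset.univ.filter (fun a => Q.tgt a = v)).card

/-- out-degree of a vertex -/
def outdeg (v : Q.V) : ℕ := (Finset.univ.filter (fun a => Q.src a = v)).card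

/-- a list of arrows is composable (forms a path) -/
def Composable (l : List Q.Arr) : Prop := l.Chain' (fun a b => Q.tgt a = Q.src b)

variable {Q}

/-- source vertex of a nonempty word -/
def wSrc? (l : List Q.Arr) : Option Q.V := l.head?.map Q.src

/-- target vertex of a nonempty word -/
def wTgt? (l : List Q.Arr) : Option Q.V := l.getLast?.map Q.tgt

/-- target of a word, with a default value (used for stationary paths) -/
def wTgtD (l : List Q.Arr) (v : Q.V) : Q.V := (l.getLast?.map Q.tgt).getD v

/-- last arrow of a word, with a (junk) default -/
def wLast (l : List Q.Arr) : Q.Arr := l.getLast?.getD (Classical.arbitrary _)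

variable (rel : Q.Arr → Q.Arr → Prop)

/-- A word is allowed (is a basis path of `A = kQ/I`) if consecutive arrows are
composable and no consecutive pair lies in the relation set generating `I`. -/
def AllowedWord (l : List Q.Arr) : Prop :=
  l.Chain' (fun a b => Q.tgt a = Q.src b ∧ ¬ rel a b)

/-- right maximal paths (of positive length) -/
def RightMaxWord (l : List Q.Arr) : Prop :=
  l ≠ [] ∧ AllowedWord rel l ∧ ∀ a : Q.Arr, ¬ AllowedWord rel (l ++ [a])

/-- left maximal paths (of positive length) -/
def LeftMaxWord (l : List Q.Arr) : Prop :=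
  l ≠ [] ∧ AllowedWord rel l ∧ ∀ a : Q.Arr, ¬ AllowedWord rel (a :: l)

/-- finite maximal paths -/
def FiniteMaxWord (l : List Q.Arr) : Prop := RightMaxWord rel l ∧ LeftMaxWord rel l

/-- a word is primitive if it is not a proper power -/
def PrimitiveWord (l : List Q.Arr) : Prop :=
  ∀ (l' : List Q.Arr) (n : ℕ), 2 ≤ n → l ≠ (List.replicate n l').flatten

/-- a primitive cycle `c` with `c² ∉ I`; these represent the infinite maximal paths `c^∞`. -/
def PrimCycleSq (c : List Q.Arr) : Prop :=
  c ≠ [] ∧ AllowedWord rel (c ++ c) ∧ wTgt? c = wSrc? c ∧ PrimitiveWord c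

/-- the maximal path `γ_α` containing `α` is infinite -/
def InfThrough (a : Q.Arr) : Prop := ∃ c, PrimCycleSq rel c ∧ a ∈ c

/-- the maximal path `γ_α` containing `α` is finite -/
def FinThrough (a : Q.Arr) : Prop := ∃ l, FiniteMaxWord rel l ∧ a ∈ l

/-- the rotation of the cycle `c` starting at the arrow `a`; when `a ∈ c` and `c` has no
duplicates this is the primitive cycle `γ_r(a)`. -/
def rotTo (c : List Q.Arr) (a : Q.Arr) : List Q.Arr :=
  c.dropWhile (fun b => b != a) ++ c.takeWhile (fun b => b != a)

/-- the relation set of the Koszul dual `A#`; its allowed words are the forbidden paths of `A`. -/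
def dualRel : Q.Arr → Q.Arr → Prop := fun a b => Q.tgt a = Q.src b ∧ ¬ rel a b

/-- a forbidden path of `A`, i.e. a path of the Koszul dual `A#` -/
def ForbiddenWord (l : List Q.Arr) : Prop := AllowedWord (dualRel rel) l

variable (Q)

/-- The defining conditions (i)-(iv) of a (locally) gentle algebra, in terms of the set of
length-two relations generating the ideal `I`: an algebra satisfying them is gentle if it
is finite dimensional and locally gentle otherwise. -/
structure IsGentleRel : Prop where
  indeg_le : ∀ v : Q.V, indeg Q v ≤ 2
  outdeg_le : ∀ v : Q.V, outdeg Q v ≤ 2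
  rel_comp : ∀ a b : Q.Arr, rel a b → Q.tgt a = Q.src b
  cond_ii : ∀ a b b' : Q.Arr, b ≠ b' → Q.tgt b = Q.src a → Q.tgt b' = Q.src a →
    Xor' (rel b a) (rel b' a)
  cond_iii : ∀ a b b' : Q.Arr, b ≠ b' → Q.tgt a = Q.src b → Q.tgt a = Q.src b' →
    Xor' (rel a b) (rel a b')

/-- `Q` is (as a quiver) the extended Dynkin quiver `Ã_n` (for `n = |Q₀| - 1`):
every vertex has in-degree and out-degree one. -/
def IsAtilde : Prop := ∀ v : Q.V, indeg Q v = 1 ∧ outdeg Q v = 1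

/-- paths of `Q`, including the stationary paths (`w = []`) at each vertex -/
structure Pth where
  s : Q.V
  w : List Q.Arr
  hs : ∀ a ∈ w.head?, Q.src a = s
  hc : Composable Q w

variable {Q}

/-- target of a path -/
def Pth.t (p : Pth Q) : Q.V := wTgtD p.w p.s

/-- length of a path -/
def Pth.len (p : Pth Q) : ℕ := p.w.length

/-- a basis path of `A = kQ/I` -/
def Pth.Allowed (p : Pth Q) : Prop := AllowedWord rel p.w

end LocGentle
namespace LocGentle

section PartialInjection

variable {β : Type*} {R : β → β → Prop}

open Relation

theorem transGen_self_of_transGen_left (hl : ∀ a b c, R a c → R b c → a = b) {x y : β}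
    (hxy : TransGen R x y) (hy : TransGen R y y) : TransGen R x x := by
  induction hxy using TransGen.head_induction_on with
  | single h =>
    obtain ⟨z, hz, hzy⟩ := TransGen.tail'_iff.1 hy
    obtain rfl := hl _ _ _ h hzy
    exact TransGen.head' h hz
  | head h _ ih =>
    obtain ⟨z, hz, hzy⟩ := TransGen.tail'_iff.1 ih
    obtain rfl := hl _ _ _ h hzy
    exact TransGen.head' h hz

theorem transGen_self_of_transGen_right (hr : ∀ a b c, R a b → R a c → b = c) {x y : β}
    (hxy : TransGen R x y) (hx : TransGen R x x) : TransGen R y y := by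
  rw [← transGen_swap] at hxy hx ⊢
  exact transGen_self_of_transGen_left (fun a b c h h' => hr c a b h h') hxy hx

theorem pairwise_transGen_of_isChain {l : List β} (h : l.IsChain R) :
    l.Pairwise (TransGen R) :=
  (h.imp fun _ _ => TransGen.single).pairwise

theorem exists_isChain_of_transGen {a b : β} (h : TransGen R a b) :
    ∃ t, (a :: t ++ [b]).IsChain R := by
  induction h using TransGen.head_induction_on with
  | single h => exact ⟨[], by simpa using h⟩
  | @head a c h _ ih =>
    obtain ⟨t, ht⟩ := ih
    exact ⟨c :: t, List.IsChain.cons_cons h ht⟩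

/-- A chain that meets a cycle of a partial injection lies on that cycle. -/
theorem transGen_self_of_mem_isChain (hl : ∀ a b c, R a c → R b c → a = b)
    (hr : ∀ a b c, R a b → R a c → b = c) {l : List β} (h : l.IsChain R) {x y : β}
    (hx : x ∈ l) (hy : y ∈ l) (hxx : TransGen R x x) : TransGen R y y := by
  have hp : l.Pairwise fun x y => x = y ∨ TransGen R x y ∨ TransGen R y x :=
    (pairwise_transGen_of_isChain h).imp fun h => Or.inr (Or.inl h)
  have hs : x = y ∨ TransGen R x y ∨ TransGen R y x := by
    by_cases hxy : x = y
    · exact Or.inl hxy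
    · have : Std.Symm fun x y => x = y ∨ TransGen R x y ∨ TransGen R y x :=
        ⟨fun a b h => h.imp Eq.symm Or.symm⟩
      exact hp.forall hx hy hxy
  rcases hs with rfl | h | h
  · exact hxx
  · exact transGen_self_of_transGen_right hr h hxx
  · exact transGen_self_of_transGen_left hl h hxx

theorem prefix_of_isChain_cons (hr : ∀ a b c, R a b → R a c → b = c) {l l' : List β} {a : β}
    (h : (a :: l).IsChain R) (h' : (a :: l').IsChain R) (hlen : l.length ≤ l'.length) :
    l <+: l' := by
  induction l generalizing a l' with
  | nil => exact ⟨_, rfl⟩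
  | cons b l ih =>
    cases l' with
    | nil => simp at hlen
    | cons b' l' =>
      rw [List.isChain_cons_cons] at h h'
      obtain rfl := hr _ _ _ h.1 h'.1
      exact (List.prefix_cons_inj _).2 (ih h.2 h'.2 (by simpa using hlen))

theorem eq_of_isChain_cons_maximal (hr : ∀ a b c, R a b → R a c → b = c) {l l' : List β} {a : β}
    (h : (a :: l).IsChain R) (h' : (a :: l').IsChain R)
    (hm : ∀ b, ¬ (a :: l ++ [b]).IsChain R) (hm' : ∀ b, ¬ (a :: l' ++ [b]).IsChain R) :
    l = l' := by
  wlog hlen : l.length ≤ l'.length generalizing l l'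
  · exact (this h' h hm' hm (by omega)).symm
  obtain ⟨t, rfl⟩ := prefix_of_isChain_cons hr h h' hlen
  cases t with
  | nil => simp
  | cons b t =>
    refine absurd (List.IsChain.left_of_append (l₂ := t) ?_) (hm b)
    simpa using h'

theorem isChain_append_singleton_of_suffix {p q : List β} {a b : β}
    (h : (p ++ a :: q).IsChain R) (hb : (a :: q ++ [b]).IsChain R) :
    (p ++ a :: q ++ [b]).IsChain R := by
  have := List.isChain_split.2 ⟨(List.isChain_split.1 h).1, hb⟩
  simpa using this

/-- In a partial injection, a chain that can be extended on neither side is determined by any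
of its elements. -/
theorem eq_of_mem_isChain_maximal (hl : ∀ a b c, R a c → R b c → a = b)
    (hr : ∀ a b c, R a b → R a c → b = c) {l l' : List β} {a : β}
    (h : l.IsChain R) (h' : l'.IsChain R) (ha : a ∈ l) (ha' : a ∈ l')
    (hmr : ∀ b, ¬ (l ++ [b]).IsChain R) (hmr' : ∀ b, ¬ (l' ++ [b]).IsChain R)
    (hml : ∀ b, ¬ (b :: l).IsChain R) (hml' : ∀ b, ¬ (b :: l').IsChain R) : l = l' := by
  obtain ⟨p, q, rfl⟩ := List.append_of_mem ha
  obtain ⟨p', q', rfl⟩ := List.append_of_mem ha'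
  have hq : q = q' := eq_of_isChain_cons_maximal hr h.right_of_append h'.right_of_append
    (fun b hb => hmr b (isChain_append_singleton_of_suffix h hb))
    (fun b hb => hmr' b (isChain_append_singleton_of_suffix h' hb))
  have key : ∀ {p q : List β}, (p ++ a :: q).IsChain R → (∀ b, ¬ (b :: (p ++ a :: q)).IsChain R) →
      (a :: p.reverse).IsChain (flip R) ∧
        ∀ b, ¬ (a :: p.reverse ++ [b]).IsChain (flip R) := by
    intro p q h hm
    have e : a :: p.reverse = (p ++ [a]).reverse := by simp
    refine ⟨?_, fun b hb => hm b ?_⟩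
    · rw [e, List.isChain_reverse]
      exact (List.isChain_split.1 h).1
    · have e' : a :: p.reverse ++ [b] = (b :: p ++ [a]).reverse := by simp
      rw [e', List.isChain_reverse] at hb
      exact (List.isChain_split (l₁ := b :: p)).2 ⟨hb, (List.isChain_split.1 h).2⟩
  have hp : p.reverse = p'.reverse :=
    eq_of_isChain_cons_maximal (R := flip R) (fun a b c h h' => hl b c a h h')
      (key h hml).1 (key h' hml').1 (key h hml).2 (key h' hml').2
  rw [hq, List.reverse_injective hp]

theorem exists_isChain_maximal [Fintype β] (hl : ∀ a b c, R a c → R b c → a = b)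
    (hr : ∀ a b c, R a b → R a c → b = c) {a : β} (ha : ¬ TransGen R a a) :
    ∃ l : List β, l.IsChain R ∧ a ∈ l ∧ (∀ b, ¬ (l ++ [b]).IsChain R) ∧
      ∀ b, ¬ (b :: l).IsChain R := by
  have hbound : ∀ l : List β, l.IsChain R → a ∈ l → l.length ≤ Fintype.card β := by
    intro l h hal
    refine List.Nodup.length_le_card ((pairwise_transGen_of_isChain h).imp_of_mem ?_)
    rintro x _ hx _ hxx rfl
    exact ha (transGen_self_of_mem_isChain hl hr h hx hal hxx)
  obtain ⟨l, ⟨h, hal⟩, hmax⟩ := WellFounded.has_min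
    (measure fun l : List β => Fintype.card β - l.length).wf
    {l | l.IsChain R ∧ a ∈ l} ⟨[a], by simp⟩
  replace hmax : ∀ l' : List β, l'.IsChain R → a ∈ l' → l'.length ≤ l.length := by
    intro l' h' hal'
    have h1 : ¬ Fintype.card β - l'.length < Fintype.card β - l.length := hmax l' ⟨h', hal'⟩
    have := hbound l' h' hal'
    omega
  refine ⟨l, h, hal, fun b hb => ?_, fun b hb => ?_⟩
  · have := hmax _ hb (by simp [hal])
    simp at this
  · have := hmax _ hb (by simp [hal])
    simp at this

/-- A shortest closed chain through `a` generates all closed chains through `a`. -/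
theorem exists_eq_flatten_replicate (hr : ∀ a b c, R a b → R a c → b = c) {a : β} {t : List β}
    (ht : (a :: t ++ [a]).IsChain R)
    (hmin : ∀ s : List β, (a :: s ++ [a]).IsChain R → t.length ≤ s.length) {s : List β}
    (hs : (a :: s ++ [a]).IsChain R) :
    ∃ n, a :: s = (List.replicate (n + 1) (a :: t)).flatten := by
  induction hn : s.length using Nat.strong_induction_on generalizing s with
  | _ n ih =>
    obtain ⟨r, hr'⟩ := prefix_of_isChain_cons hr ht hs (by simpa using hmin s hs)
    rcases List.eq_nil_or_concat' r with rfl | ⟨r, x, rfl⟩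
    · refine ⟨0, ?_⟩
      simp at hr'
      simp [hr']
    · have e : t ++ a :: r ++ [x] = s ++ [a] := by simpa using hr'
      obtain ⟨e, ex⟩ := List.append_inj' e rfl
      obtain rfl : x = a := by simpa using ex
      subst e
      have hc : (x :: r ++ [x]).IsChain R :=
        hs.suffix ⟨x :: t, by simp⟩
      obtain ⟨m, hm⟩ := ih r.length (by subst hn; simp; omega) hc rfl
      refine ⟨m + 1, ?_⟩
      rw [List.replicate_succ, List.flatten_cons, ← hm]
      simp

theorem exists_minimal_closed_isChain {a : β} (ha : TransGen R a a) :
    ∃ t : List β, (a :: t ++ [a]).IsChain R ∧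
      ∀ s : List β, (a :: s ++ [a]).IsChain R → t.length ≤ s.length := by
  obtain ⟨t, ht, hmin⟩ := WellFounded.has_min (measure (List.length (α := β))).wf
    {t | (a :: t ++ [a]).IsChain R} (exists_isChain_of_transGen ha)
  exact ⟨t, ht, fun s hs => not_lt.1 (hmin s hs)⟩

end PartialInjection

theorem IsGentleRel.pred_unique {Q : Quiv} {rel : Q.Arr → Q.Arr → Prop} (h : IsGentleRel Q rel)
    (a b c : Q.Arr) (ha : dualRel rel a c) (hb : dualRel rel b c) : a = b := by
  by_contra hab
  rcases h.cond_ii c a b hab ha.1 hb.1 with h | h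
  · exact ha.2 h.1
  · exact hb.2 h.1

theorem IsGentleRel.succ_unique {Q : Quiv} {rel : Q.Arr → Q.Arr → Prop} (h : IsGentleRel Q rel)
    (a b c : Q.Arr) (hb : dualRel rel a b) (hc : dualRel rel a c) : b = c := by
  by_contra hbc
  rcases h.cond_iii a b c hbc hb.1 hc.1 with h | h
  · exact hb.2 h.1
  · exact hc.2 h.1

theorem allowedWord_iff {Q : Quiv} {rel : Q.Arr → Q.Arr → Prop} {l : List Q.Arr} :
    AllowedWord rel l ↔ l.IsChain (dualRel rel) := Iff.rfl

theorem allowedWord_closed {Q : Quiv} {rel : Q.Arr → Q.Arr → Prop} {a : Q.Arr} {t : List Q.Arr}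
    (h : AllowedWord rel (a :: t ++ a :: t)) : AllowedWord rel (a :: t ++ [a]) :=
  allowedWord_iff.2 <| List.IsChain.left_of_append (l₂ := t) <| by
    simpa using allowedWord_iff.1 h

theorem transGen_of_primCycleSq {Q : Quiv} {rel : Q.Arr → Q.Arr → Prop} {a : Q.Arr}
    {c : List Q.Arr} (hc : PrimCycleSq rel c) (ha : c.head? = some a) :
    Relation.TransGen (dualRel rel) a a := by
  obtain ⟨t, rfl⟩ := List.head?_eq_some_iff.1 ha
  have := pairwise_transGen_of_isChain (allowedWord_iff.1 (allowedWord_closed hc.2.1))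
  exact List.rel_of_pairwise_cons this (by simp)

theorem not_finiteMaxWord_of_transGen {Q : Quiv} {rel : Q.Arr → Q.Arr → Prop}
    (h : IsGentleRel Q rel) {a : Q.Arr} (ha : Relation.TransGen (dualRel rel) a a)
    {l : List Q.Arr} (hal : a ∈ l) : ¬ FiniteMaxWord rel l := by
  rintro ⟨⟨hne, hl, hm⟩, -⟩
  obtain ⟨z, hz, -⟩ := Relation.TransGen.head'_iff.1 (transGen_self_of_mem_isChain h.pred_unique
    h.succ_unique hl hal (List.getLast_mem hne) ha)
  refine hm z (List.isChain_append.2 ⟨hl, List.isChain_singleton z, ?_⟩)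
  intro x hx y hy
  rw [List.getLast?_eq_some_getLast hne] at hx
  simp only [Option.mem_def, Option.some.injEq, List.head?_cons] at hx hy
  subst hx hy
  exact hz

theorem existsUnique_finiteMaxWord {Q : Quiv} {rel : Q.Arr → Q.Arr → Prop}
    (h : IsGentleRel Q rel) {a : Q.Arr} (ha : ¬ Relation.TransGen (dualRel rel) a a) :
    ∃! l : List Q.Arr, FiniteMaxWord rel l ∧ a ∈ l := by
  obtain ⟨l, hl, hal, hr, hl'⟩ := exists_isChain_maximal h.pred_unique h.succ_unique ha
  have hne := List.ne_nil_of_mem hal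
  refine ⟨l, ⟨⟨⟨hne, hl, hr⟩, hne, hl, hl'⟩, hal⟩, ?_⟩
  rintro m ⟨⟨⟨-, hm, hmr⟩, -, -, hml⟩, ham⟩
  exact eq_of_mem_isChain_maximal h.pred_unique h.succ_unique hm hl ham hal hmr hr hml hl'

theorem existsUnique_primCycleSq {Q : Quiv} {rel : Q.Arr → Q.Arr → Prop}
    (h : IsGentleRel Q rel) {a : Q.Arr} (ha : Relation.TransGen (dualRel rel) a a) :
    ∃! c : List Q.Arr, PrimCycleSq rel c ∧ c.head? = some a := by
  obtain ⟨t, ht, hmin⟩ := exists_minimal_closed_isChain ha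
  refine ⟨a :: t, ⟨⟨by simp, ?_, ?_, ?_⟩, rfl⟩, ?_⟩
  · exact List.isChain_split.2 ⟨ht, ht.left_of_append⟩
  · have := (List.isChain_append.1 ht).2.2 _
      (List.getLast?_eq_some_getLast (List.cons_ne_nil a t)) a rfl
    simp [wTgt?, wSrc?, List.getLast?_eq_some_getLast (List.cons_ne_nil a t), this.1]
  · intro l n hn e
    obtain ⟨n, rfl⟩ := Nat.exists_eq_add_of_le' hn
    cases l with
    | nil => simp at e
    | cons b l =>
      rw [List.replicate_succ, List.replicate_succ, List.flatten_cons, List.flatten_cons] at e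
      obtain ⟨rfl, e⟩ := List.cons.inj e
      subst e
      have := hmin l (List.IsChain.left_of_append
        (l₂ := l ++ (List.replicate n (a :: l)).flatten ++ [a]) (by simpa using ht))
      simp at this
  · rintro c ⟨⟨-, hc, -, hprim⟩, hhead⟩
    obtain ⟨s, rfl⟩ := List.head?_eq_some_iff.1 hhead
    obtain ⟨n, hn⟩ := exists_eq_flatten_replicate h.succ_unique ht hmin (allowedWord_closed hc)
    cases n with
    | zero => simpa using hn
    | succ n => exact absurd hn (hprim _ _ (by omega))

/-- **Lemma 2.7 (lem:maxpaths).** Let `A = kQ/I` be a (locally) gentle algebra.  For every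
arrow `α ∈ Q₁` exactly one of the following holds: (1) `α` is contained in a unique finite
maximal path of `A`; (2) `α` is contained in a unique primitive cycle `c` with first arrow
`α` such that `c² ∉ I`. -/
theorem statement0 (k : Type) [Field k] [CharZero k] (Q : Quiv)
    (rel : Q.Arr → Q.Arr → Prop) (hgentle : IsGentleRel Q rel) (α : Q.Arr) :
    Xor'
      (∃! l : List Q.Arr, FiniteMaxWord rel l ∧ α ∈ l)
      (∃! c : List Q.Arr, PrimCycleSq rel c ∧ c.head? = some α) := by
  by_cases hα : Relation.TransGen (dualRel rel) α α
  · exact Or.inr ⟨existsUnique_primCycleSq hgentle hα,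
      fun ⟨_, hl, _⟩ => not_finiteMaxWord_of_transGen hgentle hα hl.2 hl.1⟩
  · exact Or.inl ⟨existsUnique_finiteMaxWord hgentle hα,
      fun ⟨_, hc, _⟩ => hα (transGen_of_primCycleSq hc.1 hc.2)⟩

end LocGentle
end
end

section
/- Let A = kQ/I be a (locally) gentle algebra whose basis B contains no finite maximal paths. Then indeg(v) = outdeg(v) for every vertex v ∈ Q0, and exactly one of the following holds: (1) indeg(v) = outdeg(v) = 1 for all v ∈ Q0 and A = kÃ_n (i.e., I = 0 and Q is the extended Dynkin quiver Ã_n); (2) indeg(v) = outdeg(v) = 2 for all v ∈ Q0, so |Q1| = 2|Q0|; (3) there is an arrow α with source v and target w such that indeg(v) = 1 and indeg(w) = 2. -/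
/- Common framework for (locally) gentle algebras -/

noncomputable section
open scoped BigOperators
open CategoryTheory

namespace LocGentle

variable {Q : Quiv} {rel : Q.Arr → Q.Arr → Prop}

theorem IsGentleRel.dualRel_right_unique (h : IsGentleRel Q rel) {a b b' : Q.Arr}
    (hb : dualRel rel a b) (hb' : dualRel rel a b') : b = b' := by
  by_contra hne
  rcases h.cond_iii a b b' hne hb.1 hb'.1 with h' | h'
  exacts [hb.2 h'.1, hb'.2 h'.1]

theorem IsGentleRel.dualRel_left_unique (h : IsGentleRel Q rel) {a b b' : Q.Arr}
    (hb : dualRel rel b a) (hb' : dualRel rel b' a) : b = b' := by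
  by_contra hne
  rcases h.cond_ii a b b' hne hb.1 hb'.1 with h' | h'
  exacts [hb.2 h'.1, hb'.2 h'.1]

/-- A maximal nonzero path from `c` to `a`, when `c` cannot be prolonged on the left nor `a` on
the right. -/
theorem exists_finiteMaxWord {a c : Q.Arr} (hca : Relation.ReflTransGen (dualRel rel) c a)
    (ha : ∀ b, ¬ dualRel rel a b) (hc : ∀ b, ¬ dualRel rel b c) :
    ∃ l, FiniteMaxWord rel l := by
  obtain ⟨l, hl, hlast⟩ := List.exists_isChain_cons_of_relationReflTransGen hca
  refine ⟨c :: l, ⟨by simp, hl, fun b hb => ?_⟩, by simp, hl, fun b hb => ?_⟩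
  · refine ha b ((List.isChain_append.1 hb).2.2 a ?_ b (by simp))
    rw [List.getLast?_eq_some_getLast (by simp), hlast]
    rfl
  · exact hc b (List.isChain_cons_cons.1 hb).1

/-- Without finite maximal paths, every arrow can be prolonged on the right. -/
theorem IsGentleRel.exists_dualRel (h : IsGentleRel Q rel)
    (hnofin : ¬ ∃ l : List Q.Arr, FiniteMaxWord rel l) (a : Q.Arr) : ∃ b, dualRel rel a b := by
  by_contra! ha
  have hpred (c : {c // Relation.ReflTransGen (dualRel rel) c a}) :
      ∃ b : {c // Relation.ReflTransGen (dualRel rel) c a}, dualRel rel b c := by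
    by_contra! hc
    exact hnofin (exists_finiteMaxWord c.2 ha fun b hb => hc ⟨b, .head hb c.2⟩ hb)
  choose p hp using hpred
  have hinj : Function.Injective p := fun c d hcd =>
    Subtype.ext (h.dualRel_right_unique (hp c) (hcd ▸ hp d))
  obtain ⟨c, hc⟩ := Finite.surjective_of_injective hinj ⟨a, .refl⟩
  exact ha c (by simpa [hc] using hp c)

theorem IsGentleRel.indeg_eq_outdeg (h : IsGentleRel Q rel)
    (hsucc : ∀ a : Q.Arr, ∃ b, dualRel rel a b) (v : Q.V) : indeg Q v = outdeg Q v := by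
  choose f hf using hsucc
  have hinj : Function.Injective f := fun a b hab =>
    h.dualRel_left_unique (hf a) (hab ▸ hf b)
  refine Finset.card_bijective f (Finite.injective_iff_bijective.1 hinj) fun a => ?_
  simp [(hf a).1]

/-- A property of vertices that is invariant along arrows is constant on the vertex set. -/
theorem iff_of_arrow_iff {P : Q.V → Prop} (hP : ∀ a, P (Q.src a) ↔ P (Q.tgt a)) (v w : Q.V) :
    P v ↔ P w := by
  obtain ⟨p⟩ := Q.connected.preconnected v w
  induction p with
  | nil => rfl
  | cons hadj _ ih =>
    refine Iff.trans ?_ ih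
    rcases (SimpleGraph.fromRel_adj _ _ _).1 hadj with ⟨-, ⟨a, rfl, rfl⟩ | ⟨a, rfl, rfl⟩⟩
    exacts [hP a, (hP a).symm]

theorem indeg_tgt_pos (a : Q.Arr) : 0 < indeg Q (Q.tgt a) :=
  Finset.card_pos.2 ⟨a, by simp⟩

theorem outdeg_src_pos (a : Q.Arr) : 0 < outdeg Q (Q.src a) :=
  Finset.card_pos.2 ⟨a, by simp⟩

theorem indeg_pos (heq : ∀ v, indeg Q v = outdeg Q v) (v : Q.V) : 0 < indeg Q v := by
  let a : Q.Arr := Classical.arbitrary _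
  refine (iff_of_arrow_iff (P := fun v => 0 < indeg Q v) (fun b => ?_) (Q.tgt a) v).1
    (indeg_tgt_pos a)
  exact iff_of_true (heq _ ▸ outdeg_src_pos b) (indeg_tgt_pos b)

theorem card_filter_tgt_mem (X : Finset Q.V) :
    (Finset.univ.filter fun a => Q.tgt a ∈ X).card = ∑ v ∈ X, indeg Q v := by
  rw [Finset.card_eq_sum_card_fiberwise (f := Q.tgt) (t := X) (by intro a; simp)]
  refine Finset.sum_congr rfl fun v hv => congrArg Finset.card ?_
  ext a
  simp only [Finset.mem_filter, Finset.mem_univ, true_and]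
  exact ⟨fun h => h.2, fun h => ⟨h ▸ hv, h⟩⟩

theorem card_filter_src_mem (X : Finset Q.V) :
    (Finset.univ.filter fun a => Q.src a ∈ X).card = ∑ v ∈ X, outdeg Q v := by
  rw [Finset.card_eq_sum_card_fiberwise (f := Q.src) (t := X) (by intro a; simp)]
  refine Finset.sum_congr rfl fun v hv => congrArg Finset.card ?_
  ext a
  simp only [Finset.mem_filter, Finset.mem_univ, true_and]
  exact ⟨fun h => h.2, fun h => ⟨h ▸ hv, h⟩⟩

/-- In a balanced quiver, a set of vertices that no arrow enters is not left by any arrow. -/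
theorem src_mem_iff_tgt_mem (heq : ∀ v, indeg Q v = outdeg Q v) {X : Finset Q.V}
    (hX : ∀ a, Q.tgt a ∈ X → Q.src a ∈ X) (a : Q.Arr) : Q.src a ∈ X ↔ Q.tgt a ∈ X := by
  have hsub : (Finset.univ.filter fun a => Q.tgt a ∈ X) ⊆
      Finset.univ.filter fun a => Q.src a ∈ X := fun a => by simpa using hX a
  have hset := Finset.eq_of_subset_of_card_le hsub <| by
    rw [card_filter_tgt_mem, card_filter_src_mem, Finset.sum_congr rfl fun v _ => heq v]
  simpa using (Finset.ext_iff.1 hset a).symm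

/-- **Lemma 2.9 (lem:invoutdeg).** If the basis `B` of the (locally) gentle algebra
`A = kQ/I` contains no finite maximal paths, then `indeg v = outdeg v` for all vertices
`v`, and exactly one of the following holds: (1) `indeg v = outdeg v = 1` for all `v` and
`A = kÃ_n` (i.e. `Q` is the extended Dynkin quiver `Ã_n` and `I = 0`); (2)
`indeg v = outdeg v = 2` for all `v`, so `|Q₁| = 2|Q₀|`; (3) there is an arrow `α` with
source `v` and target `w` such that `indeg v = 1` and `indeg w = 2`. -/
theorem statement1 (k : Type) [Field k] [CharZero k] (Q : Quiv)
    (rel : Q.Arr → Q.Arr → Prop) (hgentle : IsGentleRel Q rel)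
    (hnofin : ¬ ∃ l : List Q.Arr, FiniteMaxWord rel l) :
    (∀ v : Q.V, indeg Q v = outdeg Q v) ∧
    (fun (P1 P2 P3 : Prop) => (P1 ∧ ¬P2 ∧ ¬P3) ∨ (¬P1 ∧ P2 ∧ ¬P3) ∨ (¬P1 ∧ ¬P2 ∧ P3))
      ((∀ v : Q.V, indeg Q v = 1 ∧ outdeg Q v = 1) ∧ ∀ a b : Q.Arr, ¬ rel a b)
      ((∀ v : Q.V, indeg Q v = 2 ∧ outdeg Q v = 2) ∧
        Fintype.card Q.Arr = 2 * Fintype.card Q.V)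
      (∃ a : Q.Arr, indeg Q (Q.src a) = 1 ∧ indeg Q (Q.tgt a) = 2) := by
  have hsucc := hgentle.exists_dualRel hnofin
  have heq := hgentle.indeg_eq_outdeg hsucc
  have hpos := indeg_pos heq
  refine ⟨heq, ?_⟩
  let a₀ : Q.Arr := Classical.arbitrary _
  by_cases h3 : ∃ a : Q.Arr, indeg Q (Q.src a) = 1 ∧ indeg Q (Q.tgt a) = 2
  · obtain ⟨a, hs, ht⟩ := h3
    refine Or.inr (Or.inr ⟨fun h => ?_, fun h => ?_, a, hs, ht⟩)
    · have := (h.1 (Q.tgt a)).1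
      omega
    · have := (h.1 (Q.src a)).1
      omega
  have hinv := src_mem_iff_tgt_mem heq (X := Finset.univ.filter fun v => indeg Q v = 2) <| by
    intro a ha
    simp only [Finset.mem_filter, Finset.mem_univ, true_and] at ha ⊢
    have h1 : indeg Q (Q.src a) ≠ 1 := fun h1 => h3 ⟨a, h1, ha⟩
    have := hpos (Q.src a)
    have := hgentle.indeg_le (Q.src a)
    omega
  simp only [Finset.mem_filter, Finset.mem_univ, true_and] at hinv
  have hconst := iff_of_arrow_iff (P := fun v => indeg Q v = 2) hinv (Q.src a₀)
  by_cases h2 : indeg Q (Q.src a₀) = 2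
  · have hall : ∀ v, indeg Q v = 2 := fun v => (hconst v).1 h2
    refine Or.inr (Or.inl ⟨fun h => ?_, ⟨fun v => ⟨hall v, heq v ▸ hall v⟩, ?_⟩, h3⟩)
    · have := (h.1 (Q.src a₀)).1
      omega
    · have := card_filter_tgt_mem (Finset.univ : Finset Q.V)
      simpa [hall, mul_comm] using this
  · have hall : ∀ v, indeg Q v = 1 := fun v => by
      have h2v : indeg Q v ≠ 2 := fun h => h2 ((hconst v).2 h)
      have := hpos v
      have := hgentle.indeg_le v
      omega
    have hout : ∀ v, outdeg Q v = 1 := fun v => heq v ▸ hall v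
    refine Or.inl ⟨⟨fun v => ⟨hall v, hout v⟩, fun a b hab => ?_⟩, fun h => ?_, h3⟩
    · obtain ⟨c, hc⟩ := hsucc a
      have hbc : b = c := Finset.card_le_one.1 (hout (Q.tgt a)).le b
        (by simp [hgentle.rel_comp a b hab]) c (by simp [hc.1])
      exact hc.2 (hbc ▸ hab)
    · exact h2 (h.1 _).1

end LocGentle
end
end

section
/- Let A = kQ/I be a locally gentle algebra with a unique maximal path γ, which is infinite. Then Z(A) = k[m_γ] is isomorphic to the polynomial algebra k[t], and A is a free Z(A)-module of rank |Q1|². In particular, if for each vertex v of out-degree 2 one chooses one arrow α_v with source v, then the set of basis paths of length < |Q1| together with the cycles γ_r(α_v) for those chosen arrows forms a Z(A)-basis of A. -/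
/- Common framework for (locally) gentle algebras -/

noncomputable section
open scoped BigOperators
open CategoryTheory

namespace LocGentle

variable (k : Type) [Field k] (Q : Quiv) (rel : Q.Arr → Q.Arr → Prop)

/-- The defining relations presenting `A = kQ/I` as a quotient of the free algebra on
the stationary paths (vertices) and arrows: the path algebra relations together with
the relations `αβ = 0` for the length-two paths `αβ` generating `I`. -/
inductive GARel : FreeAlgebra k (Q.V ⊕ Q.Arr) → FreeAlgebra k (Q.V ⊕ Q.Arr) → Prop
  | idem (v : Q.V) : GARel (FreeAlgebra.ι k (Sum.inl v) * FreeAlgebra.ι k (Sum.inl v))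
      (FreeAlgebra.ι k (Sum.inl v))
  | orth (v w : Q.V) : v ≠ w → GARel (FreeAlgebra.ι k (Sum.inl v) * FreeAlgebra.ι k (Sum.inl w)) 0
  | unit : GARel (∑ v : Q.V, FreeAlgebra.ι k (Sum.inl v)) 1
  | src_mul (a : Q.Arr) : GARel (FreeAlgebra.ι k (Sum.inl (Q.src a)) * FreeAlgebra.ι k (Sum.inr a))
      (FreeAlgebra.ι k (Sum.inr a))
  | mul_tgt (a : Q.Arr) : GARel (FreeAlgebra.ι k (Sum.inr a) * FreeAlgebra.ι k (Sum.inl (Q.tgt a)))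
      (FreeAlgebra.ι k (Sum.inr a))
  | src_zero (v : Q.V) (a : Q.Arr) : v ≠ Q.src a →
      GARel (FreeAlgebra.ι k (Sum.inl v) * FreeAlgebra.ι k (Sum.inr a)) 0
  | tgt_zero (v : Q.V) (a : Q.Arr) : v ≠ Q.tgt a →
      GARel (FreeAlgebra.ι k (Sum.inr a) * FreeAlgebra.ι k (Sum.inl v)) 0
  | rel_zero (a b : Q.Arr) : rel a b →
      GARel (FreeAlgebra.ι k (Sum.inr a) * FreeAlgebra.ι k (Sum.inr b)) 0

/-- The (locally) gentle algebra `A = kQ/I`. -/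
abbrev GA := RingQuot (GARel k Q rel)

/-- the image in `A` of the stationary path at `v` -/
def vtx (v : Q.V) : GA k Q rel := RingQuot.mkAlgHom k _ (FreeAlgebra.ι k (Sum.inl v))

/-- the image in `A` of the arrow `a` -/
def arr (a : Q.Arr) : GA k Q rel := RingQuot.mkAlgHom k _ (FreeAlgebra.ι k (Sum.inr a))

/-- the image in `A` of the word `l` (the product of its arrows) -/
def wordEl (l : List Q.Arr) : GA k Q rel := (l.map (arr k Q rel)).prod

variable {Q}

/-- the image in `A` of a path (a stationary path maps to the corresponding idempotent) -/
def Pth.el (p : Pth Q) : GA k Q rel := vtx k Q rel p.s * wordEl k Q rel p.w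

variable (Q)

/-- the `n`-th graded component `A_n` of `A`, spanned by the images of paths of length `n` -/
def deg (n : ℕ) : Submodule k (GA k Q rel) :=
  Submodule.span k {x | ∃ p : Pth Q, p.Allowed rel ∧ p.len = n ∧ x = p.el k rel}

/-- the augmentation ideal `A₊` (as a `k`-submodule), spanned by paths of positive length -/
def degPlus : Submodule k (GA k Q rel) :=
  Submodule.span k {x | ∃ p : Pth Q, p.Allowed rel ∧ 1 ≤ p.len ∧ x = p.el k rel}

/-- the Hilbert series of `A` (with integer coefficients) -/
def hilb : PowerSeries ℤ :=
  PowerSeries.mk fun n => (Module.finrank k (deg k Q rel n) : ℤ)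

/-- the Hilbert series of `A` (with rational coefficients) -/
def hilbQ : PowerSeries ℚ :=
  PowerSeries.mk fun n => (Module.finrank k (deg k Q rel n) : ℚ)

/-- the number `k_n` of finite maximal paths of length at least `n` -/
def numFMP (n : ℕ) : ℕ := {l : List Q.Arr | FiniteMaxWord rel l ∧ n ≤ l.length}.ncard

/-- the Gelfand-Kirillov dimension of `A`:
`limsup_n log (dim_k A_{≤ n}) / log n`. -/
def GKdim : ℝ :=
  Filter.limsup (fun n : ℕ =>
      Real.log (Module.finrank k ↥(⨆ i ∈ Finset.range (n + 1), deg k Q rel i)) / Real.log n)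
    Filter.atTop

/-- the central element `m_γ` attached to the infinite maximal path `γ = c^∞`:
the sum over the arrows `α` of `c` of the primitive cycle `γ_r(α)` starting at `α`. -/
def mEl (c : List Q.Arr) : GA k Q rel := (c.map fun a => wordEl k Q rel (rotTo c a)).sum

/-- evaluation of a polynomial at `x ∈ A`; `polyEval k Q rel p x` is `p(x)`. -/
def polyEval (p : Polynomial k) (x : GA k Q rel) : GA k Q rel :=
  Polynomial.eval₂ (algebraMap k (GA k Q rel)) x p

end LocGentle
namespace LocGentle

variable {Q : Quiv} {rel : Q.Arr → Q.Arr → Prop}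

/-- The combinatorial shape of a gentle quiver with a unique maximal path, which is infinite:
the arrows form a single cycle of `σ` of length `n`, and `ab ∉ I` exactly when `b = σ a`. -/
structure IsArrowCycle (rel : Q.Arr → Q.Arr → Prop) (σ : Q.Arr → Q.Arr) (n : ℕ) : Prop where
  tgt_eq : ∀ a, Q.tgt a = Q.src (σ a)
  not_rel : ∀ a, ¬ rel a (σ a)
  eq_next : ∀ a b, Q.tgt a = Q.src b → ¬ rel a b → b = σ a
  minimalPeriod_eq : ∀ a, Function.minimalPeriod σ a = n
  pos : 0 < n
  exists_iterate : ∀ a b, ∃ i, σ^[i] a = b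
  exists_src : ∀ v, ∃ a, Q.src a = v
  card_arr : Fintype.card Q.Arr = n

theorem eq_iterate_of_isChain {α : Type*} {R : α → α → Prop} {σ : α → α}
    (h : ∀ x y, R x y → y = σ x) (a : α) (l : List α) (hl : (a :: l).IsChain R) :
    a :: l = List.iterate σ a (l.length + 1) := by
  induction l generalizing a with
  | nil => rfl
  | cons b l ih =>
    rw [List.isChain_cons_cons] at hl
    obtain rfl := h a b hl.1
    have := ih _ hl.2
    rw [List.length_cons, List.iterate, ← this]

theorem iterate_mul_eq_flatten {α : Type*} {σ : α → α} {a : α} {p : ℕ}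
    (h : σ^[p] a = a) (m : ℕ) :
    List.iterate σ a (p * m) = (List.replicate m (List.iterate σ a p)).flatten := by
  induction m with
  | zero => simp
  | succ m ih =>
    rw [Nat.mul_succ, Nat.add_comm, List.iterate_add, h, ih, List.replicate_succ,
      List.flatten_cons]

theorem isChain_iterate {α : Type*} {R : α → α → Prop} {σ : α → α}
    (h : ∀ x, R x (σ x)) (a : α) (n : ℕ) : (List.iterate σ a n).IsChain R := by
  rw [List.isChain_iff_getElem]
  intro i hi
  rw [List.getElem_iterate, List.getElem_iterate, Function.iterate_succ_apply']
  exact h _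

theorem get_of_eq_iterate {α : Type*} {σ : α → α} {a : α} {l : List α} {n : ℕ}
    (h : l = List.iterate σ a n) (i : Fin l.length) : l.get i = σ^[i] a := by
  subst h
  rw [List.get_eq_getElem, List.getElem_iterate]

theorem rotTo_append_cons {l₁ l₂ : List Q.Arr} {a : Q.Arr} (h : a ∉ l₁) :
    rotTo (l₁ ++ a :: l₂) a = a :: l₂ ++ l₁ := by
  have h' : ∀ b ∈ l₁, (b != a) = true := by
    intro b hb
    simp only [bne_iff_ne, ne_eq]
    rintro rfl
    exact h hb
  rw [rotTo, List.dropWhile_append_of_pos h', List.takeWhile_append_of_pos h']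
  simp

theorem exists_src_eq {σ : Q.Arr → Q.Arr} (hσ : ∀ a, Q.tgt a = Q.src (σ a)) (v : Q.V) :
    ∃ a, Q.src a = v := by
  obtain ⟨a₀⟩ := Q.nonemptyA
  by_cases h : Q.src a₀ = v
  · exact ⟨a₀, h⟩
  obtain ⟨w⟩ := Q.connected.preconnected v (Q.src a₀)
  cases w with
  | nil => exact ⟨a₀, rfl⟩
  | cons hadj _ =>
    rw [SimpleGraph.fromRel_adj] at hadj
    obtain ⟨-, ⟨a, ha, -⟩ | ⟨a, -, ha⟩⟩ := hadj
    · exact ⟨a, ha⟩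
    · exact ⟨σ a, by rw [← hσ, ha]⟩

theorem exists_isArrowCycle (hgentle : IsGentleRel Q rel) {c : List Q.Arr}
    (hc : PrimCycleSq rel c) (hall : ∀ a : Q.Arr, a ∈ c) :
    ∃ σ : Q.Arr → Q.Arr, IsArrowCycle rel σ c.length ∧ c.Nodup ∧
      ∀ a, rotTo c a = List.iterate σ a c.length := by
  classical
  obtain ⟨hne, hcc, -, hprim⟩ := hc
  have huniq : ∀ a b b', Q.tgt a = Q.src b ∧ ¬ rel a b → Q.tgt a = Q.src b' ∧ ¬ rel a b' →
      b = b' := by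
    rintro a b b' ⟨h1, h2⟩ ⟨h3, h4⟩
    by_contra hbb
    rcases hgentle.cond_iii a b b' hbb h1 h3 with h | h
    exacts [h2 h.1, h4 h.1]
  have hex : ∀ a, ∃ b, Q.tgt a = Q.src b ∧ ¬ rel a b := by
    intro a
    obtain ⟨i, hi, rfl⟩ := List.getElem_of_mem (hall a)
    have hlen : i + 1 < (c ++ c).length := by rw [List.length_append]; omega
    have := (List.isChain_iff_getElem.mp hcc) i hlen
    rw [List.getElem_append_left hi] at this
    exact ⟨_, this⟩
  choose σ hσ using hex
  have hnext : ∀ a b, (Q.tgt a = Q.src b ∧ ¬ rel a b) → b = σ a :=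
    fun a b h => huniq a b (σ a) h (hσ a)
  have hit : ∀ l : List Q.Arr, AllowedWord rel l → ∀ a ∈ l.head?,
      l = List.iterate σ a l.length := by
    intro l hl a ha
    cases l with
    | nil => simp at ha
    | cons b l =>
      simp only [List.head?_cons, Option.mem_def, Option.some.injEq] at ha
      subst ha
      exact eq_iterate_of_isChain hnext _ _ hl
  have hpos : 0 < c.length := List.length_pos_iff.mpr hne
  obtain ⟨a₀, ha₀⟩ : ∃ a₀, a₀ ∈ c.head? := by
    cases c with
    | nil => exact absurd rfl hne
    | cons b l => exact ⟨b, rfl⟩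
  have h2 : c ++ c = List.iterate σ a₀ (c.length + c.length) := by
    have := hit (c ++ c) hcc a₀ (by rw [List.head?_append]; simp_all)
    rwa [List.length_append] at this
  rw [List.iterate_add] at h2
  obtain ⟨hc1, hc2⟩ := List.append_inj h2 (by simp)
  have hper : σ^[c.length] a₀ = a₀ := by
    rw [← Function.iterate_zero_apply σ (σ^[c.length] a₀),
      ← get_of_eq_iterate hc2 ⟨0, hpos⟩, get_of_eq_iterate hc1 ⟨0, hpos⟩, Function.iterate_zero_apply]
  have hmin : Function.minimalPeriod σ a₀ = c.length := by
    obtain ⟨m, hm⟩ := Function.IsPeriodicPt.minimalPeriod_dvd (n := c.length) hper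
    have hm2 : ¬ 2 ≤ m := by
      intro h
      apply hprim (List.iterate σ a₀ (Function.minimalPeriod σ a₀)) m h
      rw [← iterate_mul_eq_flatten Function.iterate_minimalPeriod, ← hm]
      exact hc1
    have : m ≠ 0 := by rintro rfl; omega
    obtain rfl : m = 1 := by omega
    omega
  have hpp : a₀ ∈ Function.periodicPts σ := ⟨c.length, hpos, hper⟩
  have hreach : ∀ a, ∃ i < c.length, σ^[i] a₀ = a := by
    intro a
    have := hall a
    rw [hc1, List.mem_iterate] at this
    obtain ⟨i, hi, h⟩ := this
    exact ⟨i, hi, h.symm⟩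
  have hnodup : c.Nodup := by
    rw [List.nodup_iff_injective_get]
    intro i j hij
    have hi := i.2.trans_eq hmin.symm
    have hj := j.2.trans_eq hmin.symm
    rw [get_of_eq_iterate hc1, get_of_eq_iterate hc1] at hij
    exact Fin.ext ((Function.iterate_eq_iterate_iff_of_lt_minimalPeriod hi hj).mp hij)
  have hmin' : ∀ a, Function.minimalPeriod σ a = c.length := by
    intro a
    obtain ⟨i, -, rfl⟩ := hreach a
    rw [Function.minimalPeriod_apply_iterate hpp, hmin]
  refine ⟨σ, ⟨fun a => (hσ a).1, fun a => (hσ a).2, fun a b h h' => hnext a b ⟨h, h'⟩, hmin',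
    hpos, ?_, exists_src_eq fun a => (hσ a).1, ?_⟩, hnodup, ?_⟩
  · intro a b
    obtain ⟨i, hi, rfl⟩ := hreach a
    obtain ⟨j, hj, rfl⟩ := hreach b
    refine ⟨c.length - i + j, ?_⟩
    rw [← Function.iterate_add_apply, show c.length - i + j + i = j + c.length by omega,
      Function.iterate_add_apply, hper]
  · rw [← List.toFinset_card_of_nodup hnodup, ← Finset.card_univ]
    congr 1
    ext a
    simp [hall a]
  · intro a
    obtain ⟨l₁, l₂, hl, hnot⟩ := List.eq_append_cons_of_mem (hall a)
    have hr : rotTo c a = a :: l₂ ++ l₁ := by rw [hl, rotTo_append_cons hnot]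
    have hchain : AllowedWord rel (a :: l₂ ++ l₁) := by
      have hsplit : c ++ c = l₁ ++ (a :: l₂ ++ l₁) ++ a :: l₂ := by
        rw [hl]
        simp
      rw [hsplit] at hcc
      exact hcc.left_of_append.right_of_append
    rw [hr, hit _ hchain a (by simp)]
    congr 1
    rw [hl]
    simp
    omega

section Representation

open Polynomial

variable {σ : Q.Arr → Q.Arr} {n : ℕ} (k : Type) [Field k]

theorem IsArrowCycle.iterate_self (h : IsArrowCycle rel σ n) (a : Q.Arr) : σ^[n] a = a := by
  conv_lhs => rw [← h.minimalPeriod_eq a]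
  exact Function.iterate_minimalPeriod

theorem IsArrowCycle.dvd_of_iterate_eq (h : IsArrowCycle rel σ n) {a : Q.Arr} {l : ℕ}
    (hl : σ^[l] a = a) : n ∣ l := by
  rw [← h.minimalPeriod_eq a]
  exact Function.IsPeriodicPt.minimalPeriod_dvd hl

theorem IsArrowCycle.iterate_injOn (h : IsArrowCycle rel σ n) {a : Q.Arr} {l m : ℕ}
    (hl : l < n) (hm : m < n) (hlm : σ^[l] a = σ^[m] a) : l = m := by
  rw [← h.minimalPeriod_eq a] at hl hm
  exact (Function.iterate_eq_iterate_iff_of_lt_minimalPeriod hl hm).mp hlm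

/-- The matrix over `k[X]` representing the stationary path at `v`. -/
def vtxMat (v : Q.V) : Matrix Q.Arr Q.Arr k[X] :=
  Matrix.diagonal fun a => if Q.src a = v then 1 else 0

/-- The matrix over `k[X]` representing the arrow `a`. -/
def arrMat (σ : Q.Arr → Q.Arr) (a : Q.Arr) : Matrix Q.Arr Q.Arr k[X] :=
  Matrix.single a (σ a) X

/-- The representation of `A` by matrices over `k[X]` indexed by the arrows, in which
the arrow `a` acts as `X` times the matrix unit at `(a, σ a)`. -/
def matRep (h : IsArrowCycle rel σ n) : GA k Q rel →ₐ[k] Matrix Q.Arr Q.Arr k[X] :=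
  RingQuot.liftAlgHom k ⟨FreeAlgebra.lift k (Sum.elim (vtxMat k) (arrMat k σ)), by
    intro x y hxy
    induction hxy with
    | idem v => simp [vtxMat]
    | orth v w hvw =>
      simp only [map_mul, FreeAlgebra.lift_ι_apply, Sum.elim_inl, vtxMat, map_zero,
        Matrix.diagonal_mul_diagonal]
      rw [← Matrix.diagonal_zero]
      congr 1
      ext1 a
      by_cases ha : Q.src a = v
      · simp [ha, hvw]
      · simp [ha]
    | unit =>
      simp only [map_sum, FreeAlgebra.lift_ι_apply, Sum.elim_inl, map_one, vtxMat]
      ext1 a b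
      rw [Matrix.sum_apply]
      by_cases hab : a = b
      · subst hab; simp
      · simp [hab]
    | src_mul a =>
      simp only [map_mul, FreeAlgebra.lift_ι_apply, Sum.elim_inl, Sum.elim_inr, vtxMat, arrMat]
      ext1 b d
      by_cases hb : a = b
      · subst hb; simp
      · simp [hb]
    | mul_tgt a =>
      simp only [map_mul, FreeAlgebra.lift_ι_apply, Sum.elim_inl, Sum.elim_inr, vtxMat, arrMat]
      ext1 b d
      by_cases hd : σ a = d
      · subst hd; simp [h.tgt_eq]
      · simp [hd]
    | src_zero v a hva =>
      simp only [map_mul, FreeAlgebra.lift_ι_apply, Sum.elim_inl, Sum.elim_inr, vtxMat, arrMat,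
        map_zero]
      ext1 b d
      by_cases hb : a = b
      · subst hb; simp [hva.symm]
      · simp [hb]
    | tgt_zero v a hva =>
      simp only [map_mul, FreeAlgebra.lift_ι_apply, Sum.elim_inl, Sum.elim_inr, vtxMat, arrMat,
        map_zero]
      ext1 b d
      by_cases hd : σ a = d
      · subst hd; simp [← h.tgt_eq, hva.symm]
      · simp [hd]
    | rel_zero a b hab =>
      simp only [map_mul, FreeAlgebra.lift_ι_apply, Sum.elim_inr, arrMat, map_zero]
      apply Matrix.single_mul_single_of_ne
      rintro rfl
      exact h.not_rel a hab⟩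

theorem matRep_vtx (h : IsArrowCycle rel σ n) (v : Q.V) :
    matRep k h (vtx k Q rel v) = vtxMat k v := by
  simp [matRep, vtx]

theorem matRep_arr (h : IsArrowCycle rel σ n) (a : Q.Arr) :
    matRep k h (arr k Q rel a) = arrMat k σ a := by
  simp [matRep, arr]

variable (rel) in
/-- The image in `A` of the path of length `l` starting with `a` and following `σ`. -/
def iterEl (σ : Q.Arr → Q.Arr) (a : Q.Arr) (l : ℕ) : GA k Q rel :=
  wordEl k Q rel (List.iterate σ a l)

theorem iterEl_zero (a : Q.Arr) : iterEl rel k σ a 0 = 1 := rfl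

theorem iterEl_succ (a : Q.Arr) (l : ℕ) :
    iterEl rel k σ a (l + 1) = arr k Q rel a * iterEl rel k σ (σ a) l := by
  simp [iterEl, wordEl, List.iterate]

theorem iterEl_one (a : Q.Arr) : iterEl rel k σ a 1 = arr k Q rel a := by
  rw [iterEl_succ, iterEl_zero, mul_one]

theorem matRep_iterEl_succ (h : IsArrowCycle rel σ n) (a : Q.Arr) (l : ℕ) :
    matRep k h (iterEl rel k σ a (l + 1)) = Matrix.single a (σ^[l + 1] a) (X ^ (l + 1)) := by
  induction l generalizing a with
  | zero => simp [iterEl_one, matRep_arr, arrMat]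
  | succ l ih =>
    rw [iterEl_succ, map_mul, ih, matRep_arr, arrMat, Matrix.single_mul_single_same,
      ← Function.iterate_succ_apply, ← pow_succ']

theorem matRep_iterEl (h : IsArrowCycle rel σ n) (a : Q.Arr) {l : ℕ} (hl : l ≠ 0) :
    matRep k h (iterEl rel k σ a l) = Matrix.single a (σ^[l] a) (X ^ l) := by
  obtain ⟨l, rfl⟩ := Nat.exists_eq_succ_of_ne_zero hl
  exact matRep_iterEl_succ k h a l

theorem mk_eq_of_rel {x y : FreeAlgebra k (Q.V ⊕ Q.Arr)} (hxy : GARel k Q rel x y) :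
    RingQuot.mkAlgHom k (GARel k Q rel) x = RingQuot.mkAlgHom k (GARel k Q rel) y :=
  RingQuot.mkAlgHom_rel k hxy

theorem vtx_mul_vtx (v w : Q.V) :
    vtx k Q rel v * vtx k Q rel w = if v = w then vtx k Q rel v else 0 := by
  split_ifs with hvw
  · subst hvw
    simpa [vtx] using mk_eq_of_rel k (GARel.idem (rel := rel) v)
  · simpa [vtx] using mk_eq_of_rel k (GARel.orth (rel := rel) v w hvw)

theorem sum_vtx : ∑ v, vtx k Q rel v = 1 := by
  simpa [vtx] using mk_eq_of_rel k (GARel.unit (Q := Q) (rel := rel))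

theorem vtx_mul_arr (v : Q.V) (a : Q.Arr) :
    vtx k Q rel v * arr k Q rel a = if v = Q.src a then arr k Q rel a else 0 := by
  split_ifs with hv
  · subst hv
    simpa [vtx, arr] using mk_eq_of_rel k (GARel.src_mul (rel := rel) a)
  · simpa [vtx, arr] using mk_eq_of_rel k (GARel.src_zero (rel := rel) v a hv)

theorem arr_mul_vtx (v : Q.V) (a : Q.Arr) :
    arr k Q rel a * vtx k Q rel v = if v = Q.tgt a then arr k Q rel a else 0 := by
  split_ifs with hv
  · subst hv
    simpa [vtx, arr] using mk_eq_of_rel k (GARel.mul_tgt (rel := rel) a)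
  · simpa [vtx, arr] using mk_eq_of_rel k (GARel.tgt_zero (rel := rel) v a hv)

theorem arr_mul_arr_of_ne (h : IsArrowCycle rel σ n) {a b : Q.Arr} (hb : b ≠ σ a) :
    arr k Q rel a * arr k Q rel b = 0 := by
  by_cases hab : Q.tgt a = Q.src b
  · have : rel a b := by
      by_contra hr
      exact hb (h.eq_next a b hab hr)
    simpa [arr] using mk_eq_of_rel k (GARel.rel_zero a b this)
  · have : arr k Q rel b = vtx k Q rel (Q.src b) * arr k Q rel b := by simp [vtx_mul_arr]
    rw [this, ← mul_assoc, arr_mul_vtx, if_neg (Ne.symm hab), zero_mul]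

variable (rel) in
/-- The basis of `A` formed by all paths. -/
def pathFam (σ : Q.Arr → Q.Arr) : Q.V ⊕ Q.Arr × ℕ → GA k Q rel :=
  Sum.elim (vtx k Q rel) fun x => iterEl rel k σ x.1 (x.2 + 1)

theorem span_pathFam (h : IsArrowCycle rel σ n) :
    Submodule.span k (Set.range (pathFam rel k σ)) = ⊤ := by
  set N := Submodule.span k (Set.range (pathFam rel k σ)) with hN
  have hv : ∀ v, vtx k Q rel v ∈ N := fun v => Submodule.subset_span ⟨Sum.inl v, rfl⟩
  have hw : ∀ a l, iterEl rel k σ a (l + 1) ∈ N :=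
    fun a l => Submodule.subset_span ⟨Sum.inr (a, l), rfl⟩
  have key : ∀ (x : FreeAlgebra k (Q.V ⊕ Q.Arr)), ∀ y ∈ N,
      RingQuot.mkAlgHom k (GARel k Q rel) x * y ∈ N := by
    intro x
    induction x using FreeAlgebra.induction with
    | grade0 r =>
      intro y hy
      rw [AlgHom.commutes, ← Algebra.smul_def]
      exact N.smul_mem r hy
    | grade1 x =>
      intro y hy
      have hmap : N ≤ N.comap (LinearMap.mulLeft k
          (RingQuot.mkAlgHom k (GARel k Q rel) (FreeAlgebra.ι k x))) := by
        conv_lhs => rw [hN]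
        rw [Submodule.span_le]
        rintro _ ⟨i, rfl⟩
        rw [SetLike.mem_coe, Submodule.mem_comap, LinearMap.mulLeft_apply]
        rcases x with v | a
        · change vtx k Q rel v * _ ∈ N
          rcases i with w | ⟨b, l⟩
          · change vtx k Q rel v * vtx k Q rel w ∈ N
            rw [vtx_mul_vtx]
            split_ifs
            exacts [hv _, N.zero_mem]
          · change vtx k Q rel v * iterEl rel k σ b (l + 1) ∈ N
            rw [iterEl_succ, ← mul_assoc, vtx_mul_arr]
            split_ifs
            · rw [← iterEl_succ]
              exact hw _ _
            · rw [zero_mul]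
              exact N.zero_mem
        · change arr k Q rel a * _ ∈ N
          rcases i with w | ⟨b, l⟩
          · change arr k Q rel a * vtx k Q rel w ∈ N
            rw [arr_mul_vtx]
            split_ifs
            · rw [← iterEl_one (σ := σ)]
              exact hw _ _
            · exact N.zero_mem
          · change arr k Q rel a * iterEl rel k σ b (l + 1) ∈ N
            by_cases hb : b = σ a
            · rw [hb, ← iterEl_succ]
              exact hw _ _
            · rw [iterEl_succ, ← mul_assoc, arr_mul_arr_of_ne k h hb, zero_mul]
              exact N.zero_mem
      exact hmap hy
    | mul x x' hx hx' =>
      intro y hy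
      rw [map_mul, mul_assoc]
      exact hx _ (hx' _ hy)
    | add x x' hx hx' =>
      intro y hy
      rw [map_add, add_mul]
      exact N.add_mem (hx _ hy) (hx' _ hy)
  rw [eq_top_iff]
  rintro x -
  obtain ⟨x, rfl⟩ := RingQuot.mkAlgHom_surjective k (GARel k Q rel) x
  rw [← mul_one (RingQuot.mkAlgHom k _ x)]
  refine key x 1 ?_
  rw [← sum_vtx]
  exact N.sum_mem fun v _ => hv v

/-- The coefficient of `X ^ l` in the entry at `(a, b)`. -/
def entryCoeff (a b : Q.Arr) (l : ℕ) : Module.Dual k (Matrix Q.Arr Q.Arr k[X]) :=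
  Polynomial.lcoeff k l ∘ₗ Matrix.entryLinearMap k k[X] a b

theorem entryCoeff_apply (a b : Q.Arr) (l : ℕ) (M : Matrix Q.Arr Q.Arr k[X]) :
    entryCoeff k a b l M = (M a b).coeff l := rfl

theorem linearIndependent_matRep_pathFam (h : IsArrowCycle rel σ n) :
    LinearIndependent k (matRep k h ∘ pathFam rel k σ) := by
  choose s hs using h.exists_src
  refine LinearIndependent.of_pairwise_dual_eq_zero_one _
    (Sum.elim (fun v => entryCoeff k (s v) (s v) 0)
      fun x => entryCoeff k x.1 (σ^[x.2 + 1] x.1) (x.2 + 1)) ?_ ?_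
  · rintro (v | ⟨a, l⟩) (w | ⟨b, m⟩) hij
    · have hvw : v ≠ w := fun e => hij (congrArg _ e)
      simp [pathFam, entryCoeff_apply, matRep_vtx, vtxMat, hs, hvw]
    · simp only [Sum.elim_inl, pathFam, Function.comp_apply, Sum.elim_inr, entryCoeff_apply,
        matRep_iterEl_succ, Matrix.single_apply]
      split_ifs <;> simp
    · simp only [Sum.elim_inl, pathFam, Function.comp_apply, Sum.elim_inr, entryCoeff_apply,
        matRep_vtx, vtxMat, Matrix.diagonal_apply]
      split_ifs <;> simp [coeff_one]
    · simp only [pathFam, Function.comp_apply, Sum.elim_inr, entryCoeff_apply,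
        matRep_iterEl_succ, Matrix.single_apply]
      split_ifs with hab
      · obtain ⟨rfl, -⟩ := hab
        have : l ≠ m := by
          rintro rfl
          exact hij rfl
        simp [coeff_X_pow, this]
      · simp
  · rintro (v | ⟨a, l⟩)
    · simp [pathFam, entryCoeff_apply, matRep_vtx, vtxMat, hs]
    · simp [pathFam, entryCoeff_apply, matRep_iterEl_succ]

theorem matRep_injective (h : IsArrowCycle rel σ n) : Function.Injective (matRep k h) := by
  rw [injective_iff_map_eq_zero]
  intro x hx
  have hmem : x ∈ Submodule.span k (Set.range (pathFam rel k σ)) := by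
    rw [span_pathFam k h]
    trivial
  rw [Finsupp.mem_span_range_iff_exists_finsupp] at hmem
  obtain ⟨f, rfl⟩ := hmem
  have hf : f = 0 := by
    refine linearIndependent_iff.mp (linearIndependent_matRep_pathFam k h) f ?_
    rw [Finsupp.linearCombination_apply, ← hx, map_finsuppSum]
    simp
  simp [hf]

theorem iterate_eq_of_coeff_matRep_ne_zero (h : IsArrowCycle rel σ n) (x : GA k Q rel)
    (a b : Q.Arr) (l : ℕ) (hx : (matRep k h x a b).coeff l ≠ 0) : σ^[l] a = b := by
  by_contra hab
  apply hx
  have hle : Submodule.span k (Set.range (pathFam rel k σ)) ≤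
      LinearMap.ker (entryCoeff k a b l ∘ₗ (matRep k h).toLinearMap) := by
    rw [Submodule.span_le]
    rintro _ ⟨v | ⟨d, m⟩, rfl⟩
    · simp only [SetLike.mem_coe, LinearMap.mem_ker, LinearMap.comp_apply,
        AlgHom.toLinearMap_apply, pathFam, Sum.elim_inl, entryCoeff_apply, matRep_vtx, vtxMat,
        Matrix.diagonal_apply]
      split_ifs with h1 h2
      · have : l ≠ 0 := by
          rintro rfl
          exact hab h1
        simp [coeff_one, this]
      · simp
      · simp
    · simp only [SetLike.mem_coe, LinearMap.mem_ker, LinearMap.comp_apply,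
        AlgHom.toLinearMap_apply, pathFam, Sum.elim_inr, entryCoeff_apply, matRep_iterEl_succ,
        Matrix.single_apply]
      split_ifs with h1
      · obtain ⟨rfl, rfl⟩ := h1
        have : l ≠ m + 1 := by
          rintro rfl
          exact hab rfl
        rw [coeff_X_pow, if_neg this]
      · simp
  rw [span_pathFam k h] at hle
  exact hle (Submodule.mem_top (x := x))

variable (rel) in
/-- The sum of all cycles of length `n`. -/
def cycleSum (σ : Q.Arr → Q.Arr) (n : ℕ) : GA k Q rel := ∑ a, iterEl rel k σ a n

theorem matRep_cycleSum (h : IsArrowCycle rel σ n) :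
    matRep k h (cycleSum rel k σ n) = algebraMap k[X] _ (X ^ n) := by
  simp only [cycleSum, map_sum, matRep_iterEl k h _ h.pos.ne', h.iterate_self]
  ext1 a b
  rw [Matrix.sum_apply, Matrix.algebraMap_matrix_apply]
  by_cases hab : a = b
  · subst hab
    simp [Matrix.single_apply]
  · rw [if_neg hab]
    refine Finset.sum_eq_zero fun d _ => ?_
    rw [Matrix.single_apply, if_neg]
    rintro ⟨rfl, rfl⟩
    exact hab rfl

theorem matRep_aeval_cycleSum (h : IsArrowCycle rel σ n) (p : k[X]) :
    matRep k h (aeval (cycleSum rel k σ n) p) = algebraMap k[X] _ (expand k n p) := by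
  rw [← aeval_algHom_apply, matRep_cycleSum, aeval_algebraMap_apply, expand_eq_comp_X_pow,
    comp_eq_aeval]

theorem exists_matRep_eq_algebraMap (h : IsArrowCycle rel σ n) {z : GA k Q rel}
    (hz : z ∈ Subalgebra.center k (GA k Q rel)) :
    ∃ q : k[X], matRep k h z = algebraMap k[X] _ q := by
  have hcomm : ∀ a x y, (matRep k h z * arrMat k σ a) x y = (arrMat k σ a * matRep k h z) x y := by
    intro a x y
    rw [← matRep_arr k h, ← map_mul, ← map_mul, Subalgebra.mem_center_iff.mp hz]
  have hdiag : ∀ a, matRep k h z a a = matRep k h z (σ a) (σ a) := by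
    intro a
    have := hcomm a a (σ a)
    rw [arrMat, Matrix.mul_single_apply_same, Matrix.single_mul_apply_same, mul_comm] at this
    exact mul_left_cancel₀ X_ne_zero this
  have hoff : ∀ a y, y ≠ σ a → matRep k h z (σ a) y = 0 := by
    intro a y hy
    have := hcomm a a y
    rw [arrMat, Matrix.mul_single_apply_of_ne _ _ _ _ _ hy, Matrix.single_mul_apply_same] at this
    exact (mul_eq_zero.mp this.symm).resolve_left X_ne_zero
  obtain ⟨a₀⟩ := Q.nonemptyA
  refine ⟨matRep k h z a₀ a₀, ?_⟩
  ext1 a b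
  rw [Matrix.algebraMap_matrix_apply]
  split_ifs with hab
  · subst hab
    obtain ⟨i, rfl⟩ := h.exists_iterate a₀ a
    rw [Algebra.algebraMap_self, RingHom.id_apply]
    induction i with
    | zero => rfl
    | succ i ih => rw [Function.iterate_succ_apply', ← hdiag, ih]
  · obtain ⟨i, hi⟩ := h.exists_iterate (σ a) a
    rw [← Function.iterate_succ_apply, Function.iterate_succ_apply'] at hi
    rw [← hi]
    exact hoff _ _ (by rw [hi]; exact Ne.symm hab)

theorem cycleSum_mem_center (h : IsArrowCycle rel σ n) :
    cycleSum rel k σ n ∈ Subalgebra.center k (GA k Q rel) := by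
  rw [Subalgebra.mem_center_iff]
  intro x
  apply matRep_injective k h
  rw [map_mul, map_mul, matRep_cycleSum]
  exact (Algebra.commutes _ _).symm

theorem center_eq_adjoin (h : IsArrowCycle rel σ n) :
    Subalgebra.center k (GA k Q rel) = Algebra.adjoin k {cycleSum rel k σ n} := by
  apply le_antisymm
  · intro z hz
    obtain ⟨q, hq⟩ := exists_matRep_eq_algebraMap k h hz
    rw [Algebra.adjoin_singleton_eq_range_aeval]
    refine ⟨contract n q, matRep_injective k h ?_⟩
    change matRep k h (aeval (cycleSum rel k σ n) (contract n q)) = _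
    rw [matRep_aeval_cycleSum, hq]
    congr 1
    ext l
    rw [coeff_expand h.pos]
    split_ifs with hl
    · rw [coeff_contract h.pos.ne', Nat.div_mul_cancel hl]
    · by_contra hne
      obtain ⟨a⟩ := Q.nonemptyA
      apply hl
      apply h.dvd_of_iterate_eq (a := a)
      apply iterate_eq_of_coeff_matRep_ne_zero k h z
      rw [hq, Matrix.algebraMap_matrix_apply, if_pos rfl]
      exact Ne.symm hne
  · rw [Algebra.adjoin_le_iff, Set.singleton_subset_iff]
    exact cycleSum_mem_center k h

theorem aeval_cycleSum_injective (h : IsArrowCycle rel σ n) :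
    Function.Injective (aeval (R := k) (cycleSum rel k σ n)) := by
  intro p q hpq
  have := congrArg (matRep k h) hpq
  rw [matRep_aeval_cycleSum, matRep_aeval_cycleSum] at this
  have : Nonempty Q.Arr := Q.nonemptyA
  exact expand_injective h.pos ((FaithfulSMul.algebraMap_injective _ _) ‹_›)

theorem nonempty_equiv_center (h : IsArrowCycle rel σ n) :
    Nonempty (k[X] ≃ₐ[k] ↥(Subalgebra.center k (GA k Q rel))) :=
  ⟨(AlgEquiv.ofInjective _ (aeval_cycleSum_injective k h)).trans
    (Subalgebra.equivOfEq _ _ (by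
      rw [center_eq_adjoin k h, Algebra.adjoin_singleton_eq_range_aeval]))⟩

theorem cycleSum_mul_iterEl (h : IsArrowCycle rel σ n) (a : Q.Arr) {l : ℕ} (hl : l ≠ 0) :
    cycleSum rel k σ n * iterEl rel k σ a l = iterEl rel k σ a (l + n) := by
  apply matRep_injective k h
  rw [map_mul, matRep_cycleSum, matRep_iterEl k h a hl, matRep_iterEl k h a (by omega),
    ← Algebra.smul_def, Matrix.smul_single, Function.iterate_add_apply, h.iterate_self,
    smul_eq_mul, pow_add, mul_comm]

theorem cycleSum_mul_vtx (h : IsArrowCycle rel σ n) (v : Q.V) :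
    cycleSum rel k σ n * vtx k Q rel v =
      ∑ a ∈ Finset.univ.filter (fun a => Q.src a = v), iterEl rel k σ a n := by
  apply matRep_injective k h
  simp only [map_mul, map_sum, matRep_cycleSum, matRep_vtx, matRep_iterEl k h _ h.pos.ne',
    h.iterate_self]
  rw [← Algebra.smul_def]
  ext1 a b
  rw [Matrix.sum_apply, Matrix.smul_apply, vtxMat, Matrix.diagonal_apply]
  by_cases hab : a = b
  · subst hab
    simp [Matrix.single_apply]
  · rw [if_neg hab, smul_zero]
    symm
    refine Finset.sum_eq_zero fun d _ => ?_
    rw [Matrix.single_apply, if_neg]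
    rintro ⟨rfl, rfl⟩
    exact hab rfl

variable (rel) in
/-- The paths of length less than `n` together with the chosen cycles of length `n`. -/
def centerFam (σ : Q.Arr → Q.Arr) (n : ℕ) (ch : Q.V → Q.Arr) :
    Q.V ⊕ (Q.Arr × Fin (n - 1)) ⊕ {v : Q.V // outdeg Q v = 2} → GA k Q rel :=
  Sum.elim (vtx k Q rel) (Sum.elim (fun x => iterEl rel k σ x.1 (x.2 + 1))
    fun v => iterEl rel k σ (ch v) n)

theorem exists_src_eq_ne (h : IsArrowCycle rel σ n) (ch : Q.V → Q.Arr) (v : Q.V) :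
    ∃ a, Q.src a = v ∧ (outdeg Q v = 2 → a ≠ ch v) := by
  by_cases hv : outdeg Q v = 2
  · obtain ⟨a, ha, hne⟩ := Finset.exists_mem_ne (hv.symm ▸ Nat.one_lt_two) (ch v)
    exact ⟨a, (Finset.mem_filter.mp ha).2, fun _ => hne⟩
  · obtain ⟨a, ha⟩ := h.exists_src v
    exact ⟨a, ha, fun hv' => absurd hv' hv⟩

theorem linearIndependent_centerFam (h : IsArrowCycle rel σ n) {ch : Q.V → Q.Arr}
    (hch : ∀ v : Q.V, outdeg Q v = 2 → Q.src (ch v) = v) :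
    LinearIndependent ↥(Subalgebra.center k (GA k Q rel)) (centerFam rel k σ n ch) := by
  refine (Fintype.linearIndependent_iff (R := ↥(Subalgebra.center k (GA k Q rel)))
    (v := centerFam rel k σ n ch)).mpr ?_
  intro g hg
  choose q hq using fun i => exists_matRep_eq_algebraMap k h (g i).2
  have hentry : ∀ x y, ∑ i, q i * matRep k h (centerFam rel k σ n ch i) x y = 0 := by
    intro x y
    have := congrArg (fun M => matRep k h M x y) hg
    simpa [Subalgebra.smul_def, Matrix.sum_apply, hq, ← Algebra.smul_def] using this
  have hnotper : ∀ (a : Q.Arr) (l : Fin (n - 1)), σ^[l + 1] a ≠ a := by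
    intro a l hl
    have h1 := Nat.le_of_dvd (Nat.succ_pos _) (h.dvd_of_iterate_eq hl)
    have := l.2
    omega
  have hpath : ∀ (b : Q.Arr) (m : Fin (n - 1)) x,
      matRep k h (centerFam rel k σ n ch (Sum.inr (Sum.inl (b, m)))) x x = 0 := by
    intro b m x
    simp only [centerFam, Sum.elim_inr, Sum.elim_inl, matRep_iterEl_succ]
    rw [Matrix.single_apply, if_neg]
    rintro ⟨rfl, h'⟩
    exact hnotper _ _ h'
  have hvtx : ∀ v x y, matRep k h (centerFam rel k σ n ch (Sum.inl v)) x y =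
      if x = y ∧ Q.src x = v then 1 else 0 := by
    intro v x y
    simp only [centerFam, Sum.elim_inl, matRep_vtx, vtxMat, Matrix.diagonal_apply, ite_and]
  have hcyc : ∀ v x y, matRep k h (centerFam rel k σ n ch (Sum.inr (Sum.inr v))) x y =
      if ch v = x ∧ ch v = y then X ^ n else 0 := by
    intro v x y
    simp only [centerFam, Sum.elim_inr, matRep_iterEl k h _ h.pos.ne', h.iterate_self,
      Matrix.single_apply]
  have hvtx0 : ∀ v, q (Sum.inl v) = 0 := by
    intro v
    obtain ⟨a, hav, hne⟩ := exists_src_eq_ne h ch v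
    have := hentry a a
    rw [Fintype.sum_eq_single (Sum.inl v)] at this
    · simpa [hvtx, hav] using this
    · rintro (w | ⟨b, m⟩ | ⟨w, hw⟩) hi
      · have : Q.src a ≠ w := by
          rintro rfl
          exact hi (by rw [hav])
        simp [hvtx, this]
      · simp [hpath]
      · have : ch w ≠ a := by
          rintro rfl
          obtain rfl : w = v := (hch w hw).symm.trans hav
          exact hne hw rfl
        simp [hcyc, this]
  have hq0 : ∀ i, q i = 0 := by
    rintro (v | ⟨a, l⟩ | ⟨v, hv⟩)
    · exact hvtx0 v
    · have := hentry a (σ^[l + 1] a)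
      rw [Fintype.sum_eq_single (Sum.inr (Sum.inl (a, l)))] at this
      · simpa [centerFam, matRep_iterEl_succ, Matrix.single_apply_same] using this
      · rintro (w | ⟨b, m⟩ | ⟨w, hw⟩) hi
        · simp [hvtx0]
        · simp only [centerFam, Sum.elim_inr, Sum.elim_inl, matRep_iterEl_succ]
          rw [Matrix.single_apply, if_neg, mul_zero]
          rintro ⟨rfl, h'⟩
          have h1 := l.2
          have h2 := m.2
          have := h.iterate_injOn (by omega) (by omega) h'
          exact hi (by rw [show m = l from Fin.ext (by omega)])
        · rw [hcyc, if_neg, mul_zero]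
          rintro ⟨rfl, h'⟩
          exact hnotper _ _ h'.symm
    · have := hentry (ch v) (ch v)
      rw [Fintype.sum_eq_single (Sum.inr (Sum.inr ⟨v, hv⟩))] at this
      · simpa [hcyc] using this
      · rintro (w | ⟨b, m⟩ | ⟨w, hw⟩) hi
        · simp [hvtx0]
        · simp [hpath]
        · have : ch w ≠ ch v := by
            intro e
            obtain rfl : w = v := by rw [← hch w hw, e, hch v hv]
            exact hi rfl
          simp [hcyc, this]
  intro i
  apply Subtype.ext
  apply matRep_injective k h
  simp [hq, hq0]

theorem span_centerFam (h : IsArrowCycle rel σ n) {ch : Q.V → Q.Arr}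
    (hgentle : IsGentleRel Q rel) (hch : ∀ v : Q.V, outdeg Q v = 2 → Q.src (ch v) = v) :
    Submodule.span ↥(Subalgebra.center k (GA k Q rel)) (Set.range (centerFam rel k σ n ch)) =
      ⊤ := by
  set N := Submodule.span ↥(Subalgebra.center k (GA k Q rel))
    (Set.range (centerFam rel k σ n ch)) with hN
  have hmul : ∀ x ∈ N, cycleSum rel k σ n * x ∈ N :=
    fun x hx => N.smul_mem ⟨_, cycleSum_mem_center k h⟩ hx
  have hvtx : ∀ v, vtx k Q rel v ∈ N := fun v => Submodule.subset_span ⟨Sum.inl v, rfl⟩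
  have hsum : ∀ a, ∑ b ∈ Finset.univ.filter (fun b => Q.src b = Q.src a),
      iterEl rel k σ b n ∈ N := by
    intro a
    rw [← cycleSum_mul_vtx k h]
    exact hmul _ (hvtx _)
  have hcyc : ∀ a, iterEl rel k σ a n ∈ N := by
    intro a
    have hmem : a ∈ Finset.univ.filter (fun b => Q.src b = Q.src a) := by simp
    have hle := hgentle.outdeg_le (Q.src a)
    by_cases hd : outdeg Q (Q.src a) = 2
    · have hchN : iterEl rel k σ (ch (Q.src a)) n ∈ N :=
        Submodule.subset_span ⟨Sum.inr (Sum.inr ⟨_, hd⟩), rfl⟩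
      by_cases ha : ch (Q.src a) = a
      · rwa [ha] at hchN
      · have hpair : Finset.univ.filter (fun b => Q.src b = Q.src a) = {a, ch (Q.src a)} := by
          symm
          apply Finset.eq_of_subset_of_card_le
          · intro b hb
            simp only [Finset.mem_insert, Finset.mem_singleton] at hb
            rcases hb with rfl | rfl
            · exact hmem
            · simp [hch _ hd]
          · rw [Finset.card_pair (Ne.symm ha)]
            exact hle
        have := hsum a
        rw [hpair, Finset.sum_pair (Ne.symm ha)] at this
        exact (Submodule.add_mem_iff_left (R := ↥(Subalgebra.center k (GA k Q rel)))
          (M := GA k Q rel) N hchN).mp this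
    · have hone : Finset.univ.filter (fun b => Q.src b = Q.src a) = {a} := by
        symm
        apply Finset.eq_of_subset_of_card_le (Finset.singleton_subset_iff.mpr hmem)
        rw [Finset.card_singleton]
        rw [outdeg] at hd hle
        omega
      have := hsum a
      rwa [hone, Finset.sum_singleton] at this
  have hiter : ∀ l a, iterEl rel k σ a (l + 1) ∈ N := by
    intro l
    induction l using Nat.strong_induction_on with
    | _ l ih =>
      intro a
      rcases lt_trichotomy (l + 1) n with hlt | heq | hgt
      · exact Submodule.subset_span ⟨Sum.inr (Sum.inl (a, ⟨l, by omega⟩)), rfl⟩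
      · rw [heq]
        exact hcyc a
      · have := hmul _ (ih (l - n) (by have := h.pos; omega) a)
        rwa [cycleSum_mul_iterEl k h a (by omega), show l - n + 1 + n = l + 1 by omega] at this
  have hle : Submodule.span k (Set.range (pathFam rel k σ)) ≤ N.restrictScalars k := by
    rw [Submodule.span_le]
    rintro _ ⟨v | ⟨a, l⟩, rfl⟩
    exacts [hvtx v, hiter l a]
  rw [span_pathFam k h] at hle
  exact eq_top_iff.mpr fun x hx => hle hx

theorem card_centerFam (h : IsArrowCycle rel σ n) (hgentle : IsGentleRel Q rel) :
    Fintype.card (Q.V ⊕ (Q.Arr × Fin (n - 1)) ⊕ {v : Q.V // outdeg Q v = 2}) = n ^ 2 := by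
  have hdeg : ∀ v, outdeg Q v = 1 + if outdeg Q v = 2 then 1 else 0 := by
    intro v
    have h1 := hgentle.outdeg_le v
    have h2 : 0 < outdeg Q v := by
      obtain ⟨a, ha⟩ := h.exists_src v
      exact Finset.card_pos.mpr ⟨a, by simp [ha]⟩
    split_ifs <;> omega
  have hn : n = Fintype.card Q.V + Fintype.card {v : Q.V // outdeg Q v = 2} := by
    have h1 : Fintype.card Q.Arr = ∑ v, outdeg Q v :=
      Finset.card_eq_sum_card_fiberwise (f := Q.src)
        fun _ _ => Finset.mem_coe.mpr (Finset.mem_univ _)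
    rw [← h.card_arr, h1, Finset.sum_congr rfl fun v _ => hdeg v, Finset.sum_add_distrib,
      Fintype.card_subtype, Finset.card_filter]
    simp
  rw [Fintype.card_sum, Fintype.card_sum, Fintype.card_prod, Fintype.card_fin, h.card_arr]
  have hpos := h.pos
  obtain ⟨m, rfl⟩ : ∃ m, n = m + 1 := ⟨n - 1, by omega⟩
  rw [Nat.add_sub_cancel]
  nlinarith

theorem range_centerFam (h : IsArrowCycle rel σ n) {ch : Q.V → Q.Arr} :
    Set.range (centerFam rel k σ n ch) =
      {x | ∃ p : Pth Q, p.Allowed rel ∧ p.len < n ∧ x = p.el k rel} ∪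
      {x | ∃ v : Q.V, outdeg Q v = 2 ∧ x = iterEl rel k σ (ch v) n} := by
  ext x
  constructor
  · rintro ⟨v | ⟨a, l⟩ | ⟨v, hv⟩, rfl⟩
    · refine Or.inl ⟨⟨v, [], by simp, List.isChain_nil⟩, List.isChain_nil, h.pos, ?_⟩
      simp [centerFam, Pth.el, wordEl]
    · refine Or.inl ⟨⟨Q.src a, List.iterate σ a (l + 1), by simp [List.iterate],
        isChain_iterate h.tgt_eq _ _⟩,
        isChain_iterate (fun b => ⟨h.tgt_eq b, h.not_rel b⟩) _ _, ?_, ?_⟩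
      · have := l.2
        simp only [Pth.len, List.length_iterate]
        omega
      · change iterEl rel k σ a (l + 1) = vtx k Q rel (Q.src a) * iterEl rel k σ a (l + 1)
        rw [iterEl_succ, ← mul_assoc, vtx_mul_arr, if_pos rfl]
    · exact Or.inr ⟨v, hv, rfl⟩
  · rintro (⟨⟨v, w, hs, hc⟩, hal, hlen, rfl⟩ | ⟨v, hv, rfl⟩)
    · cases w with
      | nil => exact ⟨Sum.inl v, by simp [centerFam, Pth.el, wordEl]⟩
      | cons a w =>
        have hsa : Q.src a = v := hs a (by simp)
        have hw := eq_iterate_of_isChain (fun x y hxy => h.eq_next x y hxy.1 hxy.2) a w hal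
        have hlen' : w.length + 1 < n := hlen
        refine ⟨Sum.inr (Sum.inl (a, ⟨w.length, by omega⟩)), ?_⟩
        simp only [Pth.el]
        rw [hw]
        change iterEl rel k σ a (w.length + 1) = vtx k Q rel v * iterEl rel k σ a (w.length + 1)
        rw [iterEl_succ, ← mul_assoc, vtx_mul_arr, if_pos hsa.symm]
    · exact ⟨Sum.inr (Sum.inr ⟨v, hv⟩), rfl⟩

theorem mEl_eq_cycleSum {c : List Q.Arr} (hnodup : c.Nodup) (hall : ∀ a, a ∈ c)
    (hrot : ∀ a, rotTo c a = List.iterate σ a n) :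
    mEl k Q rel c = cycleSum rel k σ n := by
  have huniv : c.toFinset = Finset.univ := by
    ext a
    simp [hall a]
  rw [mEl, cycleSum, ← List.sum_toFinset _ hnodup, huniv]
  simp only [hrot, iterEl]

end Representation

/-- **Corollary 2.16 (cor:cyccenter).** Let `A = kQ/I` be a locally gentle algebra with a
unique maximal path `γ`, which is infinite (i.e. every arrow lies on the primitive cycle
`c` with `c² ∉ I` representing `γ = c^∞`).  Then `Z(A) = k[m_γ]` is isomorphic to the
polynomial algebra `k[t]`, and `A` is a free `Z(A)`-module of rank `|Q₁|²`.  In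
particular, if for each vertex `v` of out-degree `2` one chooses one arrow `α_v` with
source `v`, then the basis paths of length `< |Q₁|` together with the primitive cycles
`γ_r(α_v)` form a `Z(A)`-basis of `A`. -/
theorem statement5 (k : Type) [Field k] [CharZero k] (Q : Quiv)
    (rel : Q.Arr → Q.Arr → Prop) (hgentle : IsGentleRel Q rel)
    (hloc : ¬ FiniteDimensional k (GA k Q rel))
    (c : List Q.Arr) (hc : PrimCycleSq rel c) (hall : ∀ a : Q.Arr, a ∈ c) :
    Subalgebra.center k (GA k Q rel) = Algebra.adjoin k {mEl k Q rel c} ∧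
    Nonempty (Polynomial k ≃ₐ[k] ↥(Subalgebra.center k (GA k Q rel))) ∧
    Module.Free ↥(Subalgebra.center k (GA k Q rel)) (GA k Q rel) ∧
    Module.rank ↥(Subalgebra.center k (GA k Q rel)) (GA k Q rel) =
      (Fintype.card Q.Arr : Cardinal) ^ 2 ∧
    ∀ ch : Q.V → Q.Arr, (∀ v : Q.V, outdeg Q v = 2 → Q.src (ch v) = v) →
      (fun (B : Set (GA k Q rel)) =>
        Submodule.span ↥(Subalgebra.center k (GA k Q rel)) B = ⊤ ∧
        LinearIndependent ↥(Subalgebra.center k (GA k Q rel))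
          (fun x : B => (x : GA k Q rel)))
      ({x | ∃ p : Pth Q, p.Allowed rel ∧ p.len < Fintype.card Q.Arr ∧ x = p.el k rel} ∪
       {x | ∃ v : Q.V, outdeg Q v = 2 ∧ x = wordEl k Q rel (rotTo c (ch v))}) := by
  obtain ⟨σ, h, hnodup, hrot⟩ := exists_isArrowCycle hgentle hc hall
  rw [mEl_eq_cycleSum k hnodup hall hrot]
  have : Nontrivial (GA k Q rel) := (matRep k h).toRingHom.domain_nontrivial
  have hbasis : ∀ ch : Q.V → Q.Arr, (∀ v : Q.V, outdeg Q v = 2 → Q.src (ch v) = v) →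
      Submodule.span ↥(Subalgebra.center k (GA k Q rel))
          (Set.range (centerFam rel k σ c.length ch)) = ⊤ ∧
        LinearIndependent ↥(Subalgebra.center k (GA k Q rel))
          (centerFam rel k σ c.length ch) :=
    fun ch hch => ⟨span_centerFam k h hgentle hch, linearIndependent_centerFam k h hch⟩
  choose s hs using h.exists_src
  obtain ⟨hspan, hli⟩ := hbasis s fun v _ => hs v
  let b := Module.Basis.mk hli hspan.ge
  refine ⟨center_eq_adjoin k h, nonempty_equiv_center k h, Module.Free.of_basis b, ?_, ?_⟩
  · rw [rank_eq_card_basis b, card_centerFam h hgentle, h.card_arr, Nat.cast_pow]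
  · intro ch hch
    obtain ⟨hspan, hli⟩ := hbasis ch hch
    have hrange := range_centerFam k h (ch := ch)
    simp only [iterEl, ← hrot] at hrange
    rw [h.card_arr, ← hrange]
    exact ⟨hspan, hli.linearIndepOn_id⟩

end LocGentle
end
end
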